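/- Let s ≥ 2 and let P_m be a dyadic digital (t_m, m, s)-net in base 2 with t_m ≤ (1/10)·log₂ m. Let J = (J_1, J_2, J_3) be a partition of {1,…,s} with #J_i = d_i and d_1 < s. Then ∑_{k_1, k_2 = 1}^m |Υ_{d_1,d_2,d_3,J,(k_1,k_2)}| ≪ m^{2(s−1) − 1/5}, where the implied constant depends only on s. -/

import Mathlib

open MeasureTheory Filter

noncomputable section

attribute [local instance] Classical.propDecidable

/-- The `a`-th binary digit (`a ≥ 1`) of the dyadic expansion of `x ∈ [0,1)`
(the finite expansion is used for dyadic rationals). -/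
def bdigit (a : ℕ) (x : ℝ) : ℕ := (⌊x * 2 ^ a⌋).toNat % 2

/-- Digitwise addition modulo 2 of dyadic expansions: `x ⊕ y`. -/
def xorReal (x y : ℝ) : ℝ :=
  ∑' a : ℕ, (((bdigit (a + 1) x + bdigit (a + 1) y) % 2 : ℕ) : ℝ) / 2 ^ (a + 1)

/-- Coordinatewise digitwise addition `⊕` on vectors. -/
def xorVec {s : ℕ} (X Y : Fin s → ℝ) : Fin s → ℝ := fun i => xorReal (X i) (Y i)

/-- Local discrepancy `D(P, Y)` of a finite point set `P` in `[0,1)^s`. -/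
def Dloc {N s : ℕ} (P : Fin N → Fin s → ℝ) (Y : Fin s → ℝ) : ℝ :=
  (∑ n : Fin N, if ∀ i, 0 ≤ P n i ∧ P n i < Y i then (1 : ℝ) else 0) -
    (N : ℝ) * ∏ i, Y i

/-- `P` is a `(t,m,s)`-net in base 2: every elementary dyadic box of volume
`2^(t-m)` contains exactly `2^t` of the points. -/
def IsNet (t m s : ℕ) (P : Fin (2 ^ m) → Fin s → ℝ) : Prop :=
  ∀ d a : Fin s → ℕ, (∀ i, a i < 2 ^ d i) → (∑ i, d i) + t = m →
    (Finset.univ.filter fun n => ∀ i,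
        (a i : ℝ) / 2 ^ d i ≤ P n i ∧ P n i < ((a i : ℝ) + 1) / 2 ^ d i).card = 2 ^ t

/-- The digits `x_{n,i,j}` of the `n`-th point of the dyadic digital net with
generating matrices `C`. -/
def netDig (m s : ℕ) (C : Fin s → Matrix (Fin m) (Fin m) (ZMod 2)) (n : ℕ) :
    Fin s → Fin m → ZMod 2 :=
  fun i j => ∑ r : Fin m, C i j r * (if n.testBit r then 1 else 0)

/-- The `n`-th point of the dyadic digital net with generating matrices `C`. -/
def netPoint (m s : ℕ) (C : Fin s → Matrix (Fin m) (Fin m) (ZMod 2)) (n : ℕ) :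
    Fin s → ℝ :=
  fun i => ∑ j : Fin m, ((netDig m s C n i j).val : ℝ) / 2 ^ ((j : ℕ) + 1)

/-- The unit cube `[0,1]^s`. -/
def cube (s : ℕ) : Set (Fin s → ℝ) := Set.univ.pi fun _ => Set.Icc (0 : ℝ) 1

/-- The point of `Q^s(2^m)` with coordinates `T i / 2^m`. -/
def Qpt {s : ℕ} (m : ℕ) (T : Fin s → Fin (2 ^ m)) : Fin s → ℝ :=
  fun i => ((T i : ℕ) : ℝ) / 2 ^ m

/-- `M_{s,p}(P) = (2^{-sm} ∑_{T ∈ Q^s(2^m)} ∫_{[0,1]^s} |D(P ⊕ T, Y)|^p dY)^{1/p}`. -/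
def Msp (s m : ℕ) (p : ℝ) {N : ℕ} (P : Fin N → Fin s → ℝ) : ℝ :=
  ((2 : ℝ) ^ (-(s * m : ℤ)) * ∑ T : Fin s → Fin (2 ^ m),
      ∫ Y in cube s, |Dloc (fun n => xorVec (P n) (Qpt m T)) Y| ^ p) ^ (1 / p)

/-- The standard normal distribution function `Φ`. -/
def PhiCDF (w : ℝ) : ℝ :=
  (Real.sqrt (2 * Real.pi))⁻¹ * ∫ u in Set.Iio w, Real.exp (-u ^ 2 / 2)

/-- `χ_p`, the `p`-th absolute moment of the standard Gaussian. -/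
def chiMoment (p : ℝ) : ℝ :=
  (Real.sqrt (2 * Real.pi))⁻¹ * ∫ u : ℝ, |u| ^ p * Real.exp (-u ^ 2 / 2)

/-- Digits `y_{n,i,j}` of the points of the dyadic digital sequence generated by
the `ℕ × ℕ` matrices `C` over `F_2`. -/
def seqDig (s : ℕ) (C : Fin s → ℕ → ℕ → ZMod 2) (n : ℕ) : Fin s → ℕ → ZMod 2 :=
  fun i j => ∑ r ∈ Finset.range (n + 1), C i j r * (if n.testBit r then 1 else 0)

/-- The `n`-th point of the dyadic digital sequence generated by `C`. -/
def seqPoint (s : ℕ) (C : Fin s → ℕ → ℕ → ZMod 2) (n : ℕ) : Fin s → ℝ :=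
  fun i => ∑' j : ℕ, ((seqDig s C n i j).val : ℝ) / 2 ^ (j + 1)

/-- The digital sequence generated by `C` is a dyadic digital `(T,s)`-sequence:
for all `m ≥ 1` and `k ≥ 0` the block `X_{k2^m}, …, X_{k2^m+2^m-1}` is a
`(T(m),m,s)`-net in base 2. -/
def IsTSeq (s : ℕ) (Tf : ℕ → ℕ) (C : Fin s → ℕ → ℕ → ZMod 2) : Prop :=
  (∀ m, Tf m ≤ m) ∧
  ∀ m, 1 ≤ m → ∀ k : ℕ,
    IsNet (Tf m) m s fun n : Fin (2 ^ m) => seqPoint s C (k * 2 ^ m + (n : ℕ))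

/-- The dual net `P_m^⊥` of the digital net generated by `C`. -/
def dualNet (m s : ℕ) (C : Fin s → Matrix (Fin m) (Fin m) (ZMod 2)) :
    Finset (Fin s → Fin m → ZMod 2) :=
  Finset.univ.filter fun mm => ∀ n : Fin (2 ^ m),
    (∑ i, ∑ j, mm i j * netDig m s C (n : ℕ) i j) = 0

/-- `ρ(b)`: the position of the last nonzero digit (`ρ(0) = 0`). -/
def rhoF {m : ℕ} (b : Fin m → ZMod 2) : ℕ :=
  (Finset.univ.filter fun j => b j ≠ 0).sup fun j => (j : ℕ) + 1

/-- The 1-indexed component `𝔪_{i,a}` (as `0` or `1`), with the convention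
`𝔪_{i,0} = 0`. -/
def mAt {m : ℕ} (b : Fin m → ZMod 2) (a : ℕ) : ℕ :=
  if h : 1 ≤ a ∧ a ≤ m then (b ⟨a - 1, by omega⟩).val else 0

/-- The 1-indexed digit of a digit array, with the convention that digit `0`
and digits beyond `m` are `0`. -/
def dAt {m : ℕ} (y : Fin m → Fin 2) (a : ℕ) : ℕ :=
  if h : 1 ≤ a ∧ a ≤ m then (y ⟨a - 1, by omega⟩).val else 0

/-- `κ(A)`: the number of nonzero entries of `A`. -/
def kapF {s : ℕ} (A : Fin s → ℕ) : ℕ := (Finset.univ.filter fun i => A i ≠ 0).card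

/-- `a₀(A) = a₁ + ⋯ + a_s`. -/
def a0F {s : ℕ} (A : Fin s → ℕ) : ℕ := ∑ i, A i

/-- `Λ_A(T ⊕ Y^{(m)})` as a function of the digit arrays `t`, `y` of `T`, `Y`:
`∑_{𝔪 ∈ P^{⊥,*}, ρ(𝔪_i) ≤ a_i} e(∑_i (∑_j 𝔪_{i,j}(t_{i,j}+y_{i,j}) + 𝔪_{i,a_i}))`,
where `e(n) = exp(πin) = (-1)^n`. -/
def LamF (m s : ℕ) (C : Fin s → Matrix (Fin m) (Fin m) (ZMod 2)) (A : Fin s → ℕ)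
    (t y : Fin s → Fin m → Fin 2) : ℝ :=
  ∑ mm ∈ (dualNet m s C).filter fun mm => mm ≠ 0 ∧ ∀ i, rhoF (mm i) ≤ A i,
    (-1 : ℝ) ^
      (∑ i, ((∑ j, (mm i j).val * ((t i j : ℕ) + (y i j : ℕ))) + mAt (mm i) (A i)))

/-- The Rademacher function `r_A(Y)` as a function of the digit array of `Y`. -/
def rademF {m s : ℕ} (A : Fin s → ℕ) (y : Fin s → Fin m → Fin 2) : ℝ :=
  ∏ i, (-1 : ℝ) ^ dAt (y i) (A i)

/-- `Ψ_A = (-1)^{κ(A)} 2^{m-s-a₀(A)} r_A(Y) Λ_A(T ⊕ Y^{(m)})` at digit level. -/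
def PsiF (m s : ℕ) (C : Fin s → Matrix (Fin m) (Fin m) (ZMod 2)) (A : Fin s → ℕ)
    (t y : Fin s → Fin m → Fin 2) : ℝ :=
  (-1 : ℝ) ^ kapF A * (2 : ℝ) ^ ((m : ℤ) - (s : ℤ) - (a0F A : ℤ)) *
    rademF A y * LamF m s C A t y

/-- `V₀ = 10 log₂ m`. -/
def V0 (m : ℕ) : ℝ := 10 * Real.logb 2 m

/-- `I_{m,s,k} = {A ∈ I_m^s : max_i a_i = k, a₀(A) ∈ (m - t_m, m + V₀)}`. -/
def IndexSet (m s tm k : ℕ) : Finset (Fin s → ℕ) :=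
  (Fintype.piFinset fun _ : Fin s => Finset.range (m + 1)).filter fun A =>
    Finset.univ.sup A = k ∧ ((m : ℝ) - tm < a0F A ∧ (a0F A : ℝ) < m + V0 m)

/-- `I_{m,s,m+1} = {A ∈ I_m^s : a₀(A) ≥ m + V₀}`. -/
def IndexTail (m s : ℕ) : Finset (Fin s → ℕ) :=
  (Fintype.piFinset fun _ : Fin s => Finset.range (m + 1)).filter fun A =>
    (m : ℝ) + V0 m ≤ (a0F A : ℝ)

/-- `𝔇_k(T,Y) = ∑_{A ∈ I_{m,s,k}} Ψ_A` at digit level. -/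
def DDk (m s tm : ℕ) (C : Fin s → Matrix (Fin m) (Fin m) (ZMod 2)) (k : ℕ)
    (t y : Fin s → Fin m → Fin 2) : ℝ :=
  ∑ A ∈ IndexSet m s tm k, PsiF m s C A t y

/-- `R(T,Y) = ∑_{A ∈ I_{m,s,m+1}} Ψ_A` at digit level. -/
def Rtail (m s : ℕ) (C : Fin s → Matrix (Fin m) (Fin m) (ZMod 2))
    (t y : Fin s → Fin m → Fin 2) : ℝ :=
  ∑ A ∈ IndexTail m s, PsiF m s C A t y

/-- `E^{(m)}_{Y,T}(f)`: the average of `f` over all digit arrays. -/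
def Em (m s : ℕ) (f : (Fin s → Fin m → Fin 2) → (Fin s → Fin m → Fin 2) → ℝ) : ℝ :=
  (2 : ℝ) ^ (-(2 * s * m : ℤ)) *
    ∑ t : Fin s → Fin m → Fin 2, ∑ y : Fin s → Fin m → Fin 2, f t y

/-- Keep the first `k` digits of `t`, replace the remaining ones by those of `t'`. -/
def mergeDig {m s : ℕ} (k : ℕ) (t t' : Fin s → Fin m → Fin 2) :
    Fin s → Fin m → Fin 2 :=
  fun i j => if (j : ℕ) < k then t i j else t' i j

/-- The conditional expectation `E^{(m)}_{Y,T}(f | F_k)` with respect to the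
σ-field `F_k` generated by the dyadic cubes of side `2^{-k}`: the average of `f`
over the digits of index `> k`, as a function of the digit arrays `t`, `y`. -/
def EmCond (m s k : ℕ)
    (f : (Fin s → Fin m → Fin 2) → (Fin s → Fin m → Fin 2) → ℝ)
    (t y : Fin s → Fin m → Fin 2) : ℝ :=
  (2 : ℝ) ^ (-(2 * s * m : ℤ)) *
    ∑ t' : Fin s → Fin m → Fin 2, ∑ y' : Fin s → Fin m → Fin 2,
      f (mergeDig k t t') (mergeDig k y y')

/-- `Θ_{A₁,A₂,k} = E^{(m)}_{Y,T}(Ψ_{A₁}Ψ_{A₂} | F_{k-1}) - E^{(m)}_{Y,T}(Ψ_{A₁}Ψ_{A₂})`. -/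
def ThetaF (m s : ℕ) (C : Fin s → Matrix (Fin m) (Fin m) (ZMod 2))
    (A1 A2 : Fin s → ℕ) (k : ℕ) (t y : Fin s → Fin m → Fin 2) : ℝ :=
  EmCond m s (k - 1) (fun t' y' => PsiF m s C A1 t' y' * PsiF m s C A2 t' y') t y -
    Em m s fun t' y' => PsiF m s C A1 t' y' * PsiF m s C A2 t' y'

/-- `Υ_{d₁,d₂,d₃,J,k}` for a partition `J = (J₁,J₂,J₃)` of `{1,…,s}` and
`k = (k₁,k₂)`. -/
def Ups (m s tm : ℕ) (C : Fin s → Matrix (Fin m) (Fin m) (ZMod 2))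
    (J1 J2 J3 : Finset (Fin s)) (k1 k2 : ℕ) : ℝ :=
  ∑ A1 ∈ IndexSet m s tm k1, ∑ A2 ∈ IndexSet m s tm k1,
    ∑ A3 ∈ IndexSet m s tm k2, ∑ A4 ∈ IndexSet m s tm k2,
      (Em m s fun t y => ThetaF m s C A1 A2 k1 t y * ThetaF m s C A3 A4 k2 t y) *
        (if (Finset.univ.filter fun i => A1 i = A2 i) = J1 ∧
            (Finset.univ.filter fun i => A1 i < A2 i) = J2 ∧
            (Finset.univ.filter fun i => A2 i < A1 i) = J3 ∧
            (Finset.univ.filter fun i => A3 i = A4 i) = J1 ∧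
            (Finset.univ.filter fun i => A3 i < A4 i) = J2 ∧
            (Finset.univ.filter fun i => A4 i < A3 i) = J3 then (1 : ℝ) else 0)

/-- The array of the first `m` dyadic digits of the coordinates of `Y`. -/
def digitsOf (m s : ℕ) (Y : Fin s → ℝ) : Fin s → Fin m → Fin 2 :=
  fun i j => ⟨bdigit ((j : ℕ) + 1) (Y i), by unfold bdigit; omega⟩

/-- Truncation `y^{(m)}` to the first `m` dyadic digits. -/
def truncR (m : ℕ) (y : ℝ) : ℝ :=
  ∑ j ∈ Finset.range m, (bdigit (j + 1) y : ℝ) / 2 ^ (j + 1)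

/-- The elementary interval `Π_a` (`Π_0 = [0,1)`, `Π_a = [2^{-a}, 2^{1-a})`). -/
def PiBox (a : ℕ) : Set ℝ :=
  if a = 0 then Set.Ico 0 1 else Set.Ico ((2 : ℝ) ^ (-(a : ℤ))) ((2 : ℝ) ^ (1 - (a : ℤ)))

/-- `λ_A(Y) = 1_{Π_A}(Y) - vol(Π_A)`. -/
def lamA {s : ℕ} (A : Fin s → ℕ) (Y : Fin s → ℝ) : ℝ :=
  (if ∀ i, Y i ∈ PiBox (A i) then (1 : ℝ) else 0) - (2 : ℝ) ^ (-(a0F A : ℤ))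

/-- The micro-local discrepancy `λ_A(P_m^{(m)} ⊕ T ⊕ Y^{(m)})`. -/
def lamNet (m s : ℕ) (C : Fin s → Matrix (Fin m) (Fin m) (ZMod 2))
    (T Y : Fin s → ℝ) (A : Fin s → ℕ) : ℝ :=
  ∑ n : Fin (2 ^ m),
    lamA A fun i =>
      xorReal (xorReal (truncR m (netPoint m s C (n : ℕ) i)) (T i)) (truncR m (Y i))

/-- The Rademacher function `r_A(Y)` for a real point `Y`. -/
def rademReal {s : ℕ} (A : Fin s → ℕ) (Y : Fin s → ℝ) : ℝ :=
  ∏ i, if A i = 0 then (1 : ℝ) else 1 - 2 * (bdigit (A i) (Y i) : ℝ)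

/-- The truncated discrepancy
`D^{(m)}(P_m ⊕ T, Y) = 2^{-s} ∑_{A ∈ I_m^s} (-1)^{κ(A)} λ_A(P_m^{(m)} ⊕ T ⊕ Y^{(m)}) r_A(Y)`. -/
def Dm (m s : ℕ) (C : Fin s → Matrix (Fin m) (Fin m) (ZMod 2)) (T Y : Fin s → ℝ) : ℝ :=
  (2 : ℝ) ^ (-(s : ℤ)) *
    ∑ A ∈ Fintype.piFinset fun _ : Fin s => Finset.range (m + 1),
      (-1 : ℝ) ^ kapF A * lamNet m s C T Y A * rademReal A Y

/-- `𝔼_{Y,T,m}(f) = 2^{-sm} ∑_{T ∈ Q^s(2^m)} ∫_{[0,1]^s} f(T,Y) dY`. -/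
def EE (m s : ℕ) (f : (Fin s → ℝ) → (Fin s → ℝ) → ℝ) : ℝ :=
  (2 : ℝ) ^ (-(s * m : ℤ)) * ∑ T : Fin s → Fin (2 ^ m), ∫ Y in cube s, f (Qpt m T) Y
/-- Negate the digit at position `(i₀, j₀)` of a digit array. -/
def flipDig {m s : ℕ} (i₀ : Fin s) (j₀ : Fin m) (t : Fin s → Fin m → Fin 2) :
    Fin s → Fin m → Fin 2 :=
  fun i j => if i = i₀ ∧ j = j₀ then 1 - t i j else t i j

/-- The sign picked up by `Ψ_A` when both digit arrays are flipped at `(i₀, j₀)`. -/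
def flipSign {m s : ℕ} (A : Fin s → ℕ) (i₀ : Fin s) (j₀ : Fin m) : ℝ :=
  if A i₀ = (j₀ : ℕ) + 1 then -1 else 1

section Flip

variable {m s : ℕ}

lemma flipDig_involutive (i₀ : Fin s) (j₀ : Fin m) :
    Function.Involutive (flipDig i₀ j₀) := by
  intro t
  funext i j
  unfold flipDig
  split_ifs <;> simp

lemma sum_flipDig (i₀ : Fin s) (j₀ : Fin m) (f : (Fin s → Fin m → Fin 2) → ℝ) :
    ∑ t, f (flipDig i₀ j₀ t) = ∑ t, f t :=
  Equiv.sum_comp (flipDig_involutive i₀ j₀).toPerm f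

lemma mergeDig_flip_flip (i₀ : Fin s) (j₀ : Fin m) (k : ℕ) (t t' : Fin s → Fin m → Fin 2) :
    mergeDig k (flipDig i₀ j₀ t) (flipDig i₀ j₀ t') = flipDig i₀ j₀ (mergeDig k t t') := by
  funext i j
  by_cases h : (j : ℕ) < k <;> simp [mergeDig, flipDig, h]

lemma mergeDig_flip_right (i₀ : Fin s) (j₀ : Fin m) {k : ℕ} (hk : k ≤ j₀)
    (t t' : Fin s → Fin m → Fin 2) :
    mergeDig k t (flipDig i₀ j₀ t') = flipDig i₀ j₀ (mergeDig k t t') := by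
  funext i j
  by_cases h : (j : ℕ) < k
  · have hj : j ≠ j₀ := by
      rintro rfl
      omega
    simp [mergeDig, flipDig, h, hj]
  · simp [mergeDig, flipDig, h]

lemma sum_sum_flipDig (i₀ : Fin s) (j₀ : Fin m)
    (f : (Fin s → Fin m → Fin 2) → (Fin s → Fin m → Fin 2) → ℝ) :
    ∑ t, ∑ y, f (flipDig i₀ j₀ t) (flipDig i₀ j₀ y) = ∑ t, ∑ y, f t y := by
  rw [← sum_flipDig i₀ j₀ fun t => ∑ y, f t y]
  exact Finset.sum_congr rfl fun t _ => sum_flipDig i₀ j₀ fun y => f _ y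

lemma Em_eq_zero (i₀ : Fin s) (j₀ : Fin m)
    {f : (Fin s → Fin m → Fin 2) → (Fin s → Fin m → Fin 2) → ℝ}
    (hf : ∀ t y, f (flipDig i₀ j₀ t) (flipDig i₀ j₀ y) = -f t y) : Em m s f = 0 := by
  have h := sum_sum_flipDig i₀ j₀ f
  simp only [hf, Finset.sum_neg_distrib] at h
  have h0 : ∑ t, ∑ y, f t y = 0 := by linarith
  simp [Em, h0]

lemma EmCond_flip (i₀ : Fin s) (j₀ : Fin m) (k : ℕ) {σ : ℝ}
    {f : (Fin s → Fin m → Fin 2) → (Fin s → Fin m → Fin 2) → ℝ}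
    (hf : ∀ t y, f (flipDig i₀ j₀ t) (flipDig i₀ j₀ y) = σ * f t y)
    (t y : Fin s → Fin m → Fin 2) :
    EmCond m s k f (flipDig i₀ j₀ t) (flipDig i₀ j₀ y) = σ * EmCond m s k f t y := by
  unfold EmCond
  rw [← sum_sum_flipDig i₀ j₀]
  simp only [mergeDig_flip_flip, hf, ← Finset.mul_sum]
  ring

lemma EmCond_eq_zero (i₀ : Fin s) (j₀ : Fin m) {k : ℕ} (hk : k ≤ j₀)
    {f : (Fin s → Fin m → Fin 2) → (Fin s → Fin m → Fin 2) → ℝ}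
    (hf : ∀ t y, f (flipDig i₀ j₀ t) (flipDig i₀ j₀ y) = -f t y)
    (t y : Fin s → Fin m → Fin 2) : EmCond m s k f t y = 0 := by
  have h := sum_sum_flipDig i₀ j₀ fun t' y' => f (mergeDig k t t') (mergeDig k y y')
  simp only [mergeDig_flip_right i₀ j₀ hk, hf, Finset.sum_neg_distrib] at h
  have h0 : ∑ t', ∑ y', f (mergeDig k t t') (mergeDig k y y') = 0 := by linarith
  simp [EmCond, h0]

lemma even_flip_add_flip (a b : Fin 2) :
    Even (((1 - a : Fin 2) : ℕ) + ((1 - b : Fin 2) : ℕ)) ↔ Even ((a : ℕ) + (b : ℕ)) := by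
  revert a b
  decide

lemma LamF_flip (C : Fin s → Matrix (Fin m) (Fin m) (ZMod 2)) (A : Fin s → ℕ)
    (i₀ : Fin s) (j₀ : Fin m) (t y : Fin s → Fin m → Fin 2) :
    LamF m s C A (flipDig i₀ j₀ t) (flipDig i₀ j₀ y) = LamF m s C A t y := by
  unfold LamF
  refine Finset.sum_congr rfl fun mm _ => ?_
  simp only [← Finset.prod_pow_eq_pow_sum, pow_add]
  refine Finset.prod_congr rfl fun i _ => ?_
  congr 1
  refine Finset.prod_congr rfl fun j _ => ?_
  simp only [mul_comm (mm i j).val, pow_mul]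
  congr 1
  refine neg_one_pow_congr ?_
  unfold flipDig
  split_ifs
  · exact even_flip_add_flip _ _
  · rfl

lemma dAt_flip (i₀ : Fin s) (j₀ : Fin m) (A : Fin s → ℕ) (y : Fin s → Fin m → Fin 2)
    (i : Fin s) :
    (-1 : ℝ) ^ dAt (flipDig i₀ j₀ y i) (A i) =
      (if i = i₀ then flipSign A i₀ j₀ else 1) * (-1 : ℝ) ^ dAt (y i) (A i) := by
  unfold dAt
  by_cases hi : i = i₀
  · subst hi
    by_cases ha : A i = (j₀ : ℕ) + 1
    · have h1 : 1 ≤ A i ∧ A i ≤ m := by omega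
      have h2 : (⟨A i - 1, by omega⟩ : Fin m) = j₀ := by
        ext
        simp [ha]
      rw [dif_pos h1, dif_pos h1, h2]
      simp only [flipDig, flipSign, ha, and_self, if_true]
      generalize y i j₀ = b
      fin_cases b <;> simp
    · simp only [flipSign, ha, if_true, if_false, one_mul]
      split_ifs with h1
      · have h2 : (⟨A i - 1, by omega⟩ : Fin m) ≠ j₀ := by
          intro h
          have := congrArg Fin.val h
          simp only at this
          omega
        simp [flipDig, h2]
      · rfl
  · simp [flipDig, hi]

lemma rademF_flip (A : Fin s → ℕ) (i₀ : Fin s) (j₀ : Fin m) (y : Fin s → Fin m → Fin 2) :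
    rademF A (flipDig i₀ j₀ y) = flipSign A i₀ j₀ * rademF A y := by
  unfold rademF
  simp only [dAt_flip, Finset.prod_mul_distrib]
  congr 1
  simp

lemma PsiF_flip (C : Fin s → Matrix (Fin m) (Fin m) (ZMod 2)) (A : Fin s → ℕ)
    (i₀ : Fin s) (j₀ : Fin m) (t y : Fin s → Fin m → Fin 2) :
    PsiF m s C A (flipDig i₀ j₀ t) (flipDig i₀ j₀ y) =
      flipSign A i₀ j₀ * PsiF m s C A t y := by
  unfold PsiF
  rw [LamF_flip, rademF_flip]
  ring

lemma PsiF_mul_flip (C : Fin s → Matrix (Fin m) (Fin m) (ZMod 2)) (A B : Fin s → ℕ)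
    (i₀ : Fin s) (j₀ : Fin m) (t y : Fin s → Fin m → Fin 2) :
    PsiF m s C A (flipDig i₀ j₀ t) (flipDig i₀ j₀ y) *
        PsiF m s C B (flipDig i₀ j₀ t) (flipDig i₀ j₀ y) =
      flipSign A i₀ j₀ * flipSign B i₀ j₀ * (PsiF m s C A t y * PsiF m s C B t y) := by
  rw [PsiF_flip, PsiF_flip]
  ring

lemma ThetaF_eq_EmCond (C : Fin s → Matrix (Fin m) (Fin m) (ZMod 2)) {A B : Fin s → ℕ}
    (hA : ∀ i, A i ≤ m) (hB : ∀ i, B i ≤ m) (hAB : A ≠ B) (k : ℕ)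
    (t y : Fin s → Fin m → Fin 2) :
    ThetaF m s C A B k t y =
      EmCond m s (k - 1) (fun t' y' => PsiF m s C A t' y' * PsiF m s C B t' y') t y := by
  obtain ⟨i, hi⟩ := Function.ne_iff.1 hAB
  have hAi := hA i
  have hBi := hB i
  unfold ThetaF
  rw [Em_eq_zero i ⟨max (A i) (B i) - 1, by omega⟩, sub_zero]
  intro t y
  rw [PsiF_mul_flip]
  have : flipSign A i (⟨max (A i) (B i) - 1, by omega⟩ : Fin m) *
      flipSign B i (⟨max (A i) (B i) - 1, by omega⟩ : Fin m) = -1 := by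
    unfold flipSign
    rcases lt_or_gt_of_ne hi with h | h
    · rw [if_neg (by simp only; omega), if_pos (by simp only; omega)]
      norm_num
    · rw [if_pos (by simp only; omega), if_neg (by simp only; omega)]
      norm_num
  rw [this]
  ring

lemma exists_eq_of_ThetaF_ne_zero (C : Fin s → Matrix (Fin m) (Fin m) (ZMod 2))
    {A B : Fin s → ℕ} (hA : ∀ i, A i ≤ m) (hB : ∀ i, B i ≤ m) (hAB : A ≠ B) {k : ℕ}
    (hk : 1 ≤ k) (hAk : Finset.univ.sup A = k)
    {t y : Fin s → Fin m → Fin 2} (h : ThetaF m s C A B k t y ≠ 0) : ∃ i, A i = B i := by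
  by_contra! hne
  have hs : (Finset.univ : Finset (Fin s)).Nonempty := by
    by_contra hs
    rw [Finset.not_nonempty_iff_eq_empty] at hs
    rw [hs] at hAk
    simp at hAk
    omega
  obtain ⟨i, -, hi⟩ := Finset.exists_mem_eq_sup _ hs A
  have hAi : A i = k := by rw [← hi, hAk]
  have hkm : k ≤ m := hAi ▸ hA i
  apply h
  rw [ThetaF_eq_EmCond C hA hB hAB]
  have hBi := hne i
  have h1 : flipSign A i (⟨k - 1, by omega⟩ : Fin m) = -1 := if_pos (by simp only; omega)
  have h2 : flipSign B i (⟨k - 1, by omega⟩ : Fin m) = 1 := if_neg (by simp only; omega)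
  refine EmCond_eq_zero i (⟨k - 1, by omega⟩ : Fin m) (k := k - 1) le_rfl (fun t y => ?_) t y
  rw [PsiF_mul_flip, h1, h2]
  ring

lemma flipSign_prod_eq_one (C : Fin s → Matrix (Fin m) (Fin m) (ZMod 2))
    {A1 A2 A3 A4 : Fin s → ℕ} (h1 : ∀ i, A1 i ≤ m) (h2 : ∀ i, A2 i ≤ m)
    (h3 : ∀ i, A3 i ≤ m) (h4 : ∀ i, A4 i ≤ m) (h12 : A1 ≠ A2) (h34 : A3 ≠ A4) {k l : ℕ}
    (h : (Em m s fun t y => ThetaF m s C A1 A2 k t y * ThetaF m s C A3 A4 l t y) ≠ 0)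
    (i : Fin s) (j : Fin m) :
    flipSign A1 i j * flipSign A2 i j * (flipSign A3 i j * flipSign A4 i j) = 1 := by
  have hsq : flipSign A1 i j * flipSign A2 i j * (flipSign A3 i j * flipSign A4 i j) = 1 ∨
      flipSign A1 i j * flipSign A2 i j * (flipSign A3 i j * flipSign A4 i j) = -1 := by
    unfold flipSign
    split_ifs <;> norm_num
  refine hsq.resolve_right fun hneg => h (Em_eq_zero i j fun t y => ?_)
  rw [ThetaF_eq_EmCond C h1 h2 h12, ThetaF_eq_EmCond C h3 h4 h34,
    ThetaF_eq_EmCond C h1 h2 h12, ThetaF_eq_EmCond C h3 h4 h34,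
    EmCond_flip i j _ (PsiF_mul_flip C A1 A2 i j), EmCond_flip i j _ (PsiF_mul_flip C A3 A4 i j),
    mul_mul_mul_comm, hneg]
  ring

lemma eq_and_eq_of_flipSign {A1 A2 A3 A4 : Fin s → ℕ} {i : Fin s}
    (h2 : A2 i ≤ m) (h4 : A4 i ≤ m) (h12 : A1 i < A2 i) (h34 : A3 i < A4 i)
    (h : ∀ j : Fin m,
      flipSign A1 i j * flipSign A2 i j * (flipSign A3 i j * flipSign A4 i j) = 1) :
    A1 i = A3 i ∧ A2 i = A4 i := by
  have key : ∀ a, 1 ≤ a → a ≤ m →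
      ((A1 i = a ∨ A2 i = a) ↔ (A3 i = a ∨ A4 i = a)) := by
    intro a ha ham
    have := h ⟨a - 1, by omega⟩
    unfold flipSign at this
    simp only [Nat.sub_add_cancel ha] at this
    by_cases b1 : A1 i = a <;> by_cases b2 : A2 i = a <;> by_cases b3 : A3 i = a <;>
      by_cases b4 : A4 i = a <;> simp [b1, b2, b3, b4] at this ⊢ <;>
      first
        | omega
        | norm_num at this
  have k1 := key (A1 i)
  have k2 := key (A2 i)
  have k3 := key (A3 i)
  have k4 := key (A4 i)
  omega

end Flip

section Average

variable {m s : ℕ}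

lemma abs_average_le {B : ℝ}
    {f : (Fin s → Fin m → Fin 2) → (Fin s → Fin m → Fin 2) → ℝ} (hf : ∀ t y, |f t y| ≤ B) :
    |(2 : ℝ) ^ (-(2 * s * m : ℤ)) * ∑ t, ∑ y, f t y| ≤ B := by
  have h1 : |∑ t, ∑ y, f t y| ≤ (2 : ℝ) ^ (2 * s * m) * B := by
    calc |∑ t, ∑ y, f t y| ≤ ∑ t, ∑ y, |f t y| :=
          (Finset.abs_sum_le_sum_abs _ _).trans
            (Finset.sum_le_sum fun t _ => Finset.abs_sum_le_sum_abs _ _)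
      _ ≤ ∑ _t : Fin s → Fin m → Fin 2, ∑ _y : Fin s → Fin m → Fin 2, B :=
          Finset.sum_le_sum fun t _ => Finset.sum_le_sum fun y _ => hf t y
      _ = (2 : ℝ) ^ (2 * s * m) * B := by
          simp only [Finset.sum_const, Finset.card_univ, Fintype.card_fun, Fintype.card_fin,
            nsmul_eq_mul]
          push_cast
          ring
  have h2 : (2 : ℝ) ^ (-(2 * s * m : ℤ)) = ((2 : ℝ) ^ (2 * s * m))⁻¹ := by
    rw [zpow_neg]
    norm_cast
  rw [abs_mul, h2, abs_of_pos (by positivity), inv_mul_le_iff₀ (by positivity)]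
  exact h1

lemma abs_Em_le {B : ℝ}
    {f : (Fin s → Fin m → Fin 2) → (Fin s → Fin m → Fin 2) → ℝ} (hf : ∀ t y, |f t y| ≤ B) :
    |Em m s f| ≤ B :=
  abs_average_le hf

lemma abs_EmCond_le {B : ℝ} (k : ℕ)
    {f : (Fin s → Fin m → Fin 2) → (Fin s → Fin m → Fin 2) → ℝ} (hf : ∀ t y, |f t y| ≤ B)
    (t y : Fin s → Fin m → Fin 2) : |EmCond m s k f t y| ≤ B :=
  abs_average_le fun _ _ => hf _ _

end Average

section Digits

/-- The integer with binary digits `v 0, …, v (d - 1)`, most significant first. -/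
def digitPrefix (v : ℕ → ℕ) : ℕ → ℕ
  | 0 => 0
  | d + 1 => 2 * digitPrefix v d + v d

lemma digitPrefix_lt {v : ℕ → ℕ} (hv : ∀ j, v j < 2) (d : ℕ) : digitPrefix v d < 2 ^ d := by
  induction d with
  | zero => simp [digitPrefix]
  | succ d ih =>
    have := hv d
    rw [digitPrefix, pow_succ]
    omega

lemma digitPrefix_injective {v w : ℕ → ℕ} (hv : ∀ j, v j < 2) (hw : ∀ j, w j < 2) {d : ℕ}
    (h : digitPrefix v d = digitPrefix w d) : ∀ j < d, v j = w j := by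
  induction d with
  | zero => simp
  | succ d ih =>
    have h1 := hv d
    have h2 := hw d
    simp only [digitPrefix] at h
    intro j hj
    rcases Nat.lt_succ_iff_lt_or_eq.1 hj with hj | rfl
    · exact ih (by omega) j hj
    · omega

lemma digitPrefix_div_two_pow (v : ℕ → ℕ) (d : ℕ) :
    (digitPrefix v d : ℝ) / 2 ^ d = ∑ j ∈ Finset.range d, (v j : ℝ) / 2 ^ (j + 1) := by
  induction d with
  | zero => simp [digitPrefix]
  | succ d ih =>
    rw [Finset.sum_range_succ, ← ih, digitPrefix]
    push_cast
    field_simp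
    ring

lemma digit_sum_lower {v : ℕ → ℕ} {d m : ℕ} (h : d ≤ m) :
    (digitPrefix v d : ℝ) / 2 ^ d ≤ ∑ j ∈ Finset.range m, (v j : ℝ) / 2 ^ (j + 1) := by
  rw [digitPrefix_div_two_pow]
  exact Finset.sum_le_sum_of_subset_of_nonneg (Finset.range_subset_range.2 h)
    fun _ _ _ => by positivity

lemma digit_sum_upper {v : ℕ → ℕ} (hv : ∀ j, v j < 2) {d m : ℕ} (h : d ≤ m) :
    ∑ j ∈ Finset.range m, (v j : ℝ) / 2 ^ (j + 1) < ((digitPrefix v d : ℝ) + 1) / 2 ^ d := by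
  suffices ∑ j ∈ Finset.range m, (v j : ℝ) / 2 ^ (j + 1) ≤
      ((digitPrefix v d : ℝ) + 1) / 2 ^ d - 1 / 2 ^ m by
    have : (0 : ℝ) < 1 / 2 ^ m := by positivity
    linarith
  induction m, h using Nat.le_induction with
  | base => rw [← digitPrefix_div_two_pow, add_div]; simp
  | succ m hm ih =>
    rw [Finset.sum_range_succ]
    have h1 : (v m : ℝ) / 2 ^ (m + 1) ≤ 1 / 2 ^ (m + 1) := by
      have : (v m : ℝ) ≤ 1 := by exact_mod_cast Nat.lt_succ_iff.1 (hv m)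
      gcongr
    have h2 : (1 : ℝ) / 2 ^ m = 1 / 2 ^ (m + 1) + 1 / 2 ^ (m + 1) := by
      field_simp
      ring
    linarith

lemma digitPrefix_eq_of_mem {v : ℕ → ℕ} (hv : ∀ j, v j < 2) {d m a : ℕ} (h : d ≤ m)
    (h1 : (a : ℝ) / 2 ^ d ≤ ∑ j ∈ Finset.range m, (v j : ℝ) / 2 ^ (j + 1))
    (h2 : ∑ j ∈ Finset.range m, (v j : ℝ) / 2 ^ (j + 1) < ((a : ℝ) + 1) / 2 ^ d) :
    digitPrefix v d = a := by
  have h3 := h1.trans_lt (digit_sum_upper hv h)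
  have h4 := (digit_sum_lower (v := v) h).trans_lt h2
  rw [div_lt_div_iff_of_pos_right (by positivity)] at h3 h4
  norm_cast at h3 h4
  omega

end Digits

section Net

variable {m s t : ℕ} {C : Fin s → Matrix (Fin m) (Fin m) (ZMod 2)}

/-- A net realises every prescribed pattern of leading digits of total length `m - t`. -/
lemma IsNet.exists_netDig_eq (hP : IsNet t m s fun n : Fin (2 ^ m) => netPoint m s C (n : ℕ))
    {d : Fin s → ℕ} (hd : ∀ i, d i ≤ m) (hsum : (∑ i, d i) + t = m)
    (w : Fin s → Fin m → ZMod 2) :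
    ∃ n : Fin (2 ^ m), ∀ i (j : Fin m), (j : ℕ) < d i → netDig m s C n i j = w i j := by
  set ext : (Fin m → ZMod 2) → ℕ → ℕ := fun v j => if h : j < m then (v ⟨j, h⟩).val else 0
    with hext
  have hlt : ∀ v j, ext v j < 2 := by
    intro v j
    simp only [hext]
    split_ifs
    · exact ZMod.val_lt _
    · norm_num
  have hcard := hP d (fun i => digitPrefix (ext (w i)) (d i))
    (fun i => digitPrefix_lt (hlt _) _) hsum
  have hne : (Finset.univ.filter fun n : Fin (2 ^ m) => ∀ i,
      ((digitPrefix (ext (w i)) (d i) : ℕ) : ℝ) / 2 ^ d i ≤ netPoint m s C (n : ℕ) i ∧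
        netPoint m s C (n : ℕ) i <
          (((digitPrefix (ext (w i)) (d i) : ℕ) : ℝ) + 1) / 2 ^ d i).Nonempty := by
    rw [← Finset.card_pos, hcard]
    positivity
  obtain ⟨n, hn⟩ := hne
  refine ⟨n, fun i j hj => ?_⟩
  have hni := (Finset.mem_filter.1 hn).2 i
  have hpt : netPoint m s C (n : ℕ) i =
      ∑ j ∈ Finset.range m, (ext (netDig m s C n i) j : ℝ) / 2 ^ (j + 1) := by
    rw [Finset.sum_range]
    refine Finset.sum_congr rfl fun j _ => ?_
    simp [hext]
  rw [hpt] at hni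
  have h := digitPrefix_injective (hlt _) (hlt _)
    (digitPrefix_eq_of_mem (hlt _) (hd i) hni.1 hni.2) j hj
  simp only [hext, j.isLt, dif_pos] at h
  exact ZMod.val_injective 2 h

lemma eq_zero_of_rhoF_le {b : Fin m → ZMod 2} {a : ℕ} (h : rhoF b ≤ a) {j : Fin m}
    (hj : a ≤ j) : b j = 0 := by
  by_contra hb
  have : (j : ℕ) + 1 ≤ rhoF b :=
    Finset.le_sup (f := fun j : Fin m => (j : ℕ) + 1) (Finset.mem_filter.2 ⟨Finset.mem_univ j, hb⟩)
  omega

lemma IsNet.dualNet_eq_zero (hP : IsNet t m s fun n : Fin (2 ^ m) => netPoint m s C (n : ℕ))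
    {d : Fin s → ℕ} (hd : ∀ i, d i ≤ m) (hsum : (∑ i, d i) + t = m)
    {μ : Fin s → Fin m → ZMod 2} (hμ : μ ∈ dualNet m s C)
    (h0 : ∀ i (j : Fin m), d i ≤ j → μ i j = 0) : μ = 0 := by
  funext i₀ j₀
  by_contra hne
  have hj₀ : (j₀ : ℕ) < d i₀ := by
    by_contra! h
    exact hne (h0 _ _ h)
  obtain ⟨n, hn⟩ := hP.exists_netDig_eq hd hsum
    fun i j => if i = i₀ ∧ j = j₀ then 1 else 0
  have h := (Finset.mem_filter.1 hμ).2 n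
  rw [Finset.sum_eq_single i₀, Finset.sum_eq_single j₀, hn i₀ j₀ hj₀] at h
  · exact hne (by simpa using h)
  · intro j _ hj
    by_cases hjd : (j : ℕ) < d i₀
    · rw [hn _ _ hjd]
      simp [hj]
    · rw [h0 _ _ (not_lt.1 hjd), zero_mul]
  · simp
  · intro i _ hi
    refine Finset.sum_eq_zero fun j _ => ?_
    by_cases hjd : (j : ℕ) < d i
    · rw [hn _ _ hjd]
      simp [hi]
    · rw [h0 _ _ (not_lt.1 hjd), zero_mul]
  · simp

lemma exists_le_sum_eq {ι : Type*} (S : Finset ι) (a : ι → ℕ) {r : ℕ} (hr : r ≤ ∑ i ∈ S, a i) :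
    ∃ d : ι → ℕ, (∀ i, d i ≤ a i) ∧ ∑ i ∈ S, d i = r := by
  induction S using Finset.induction_on generalizing r with
  | empty => exact ⟨fun _ => 0, by simp, by simpa using (Nat.le_zero.1 (by simpa using hr)).symm⟩
  | insert x S hx ih =>
    rw [Finset.sum_insert hx] at hr
    obtain ⟨d, hd, hsum⟩ := ih (r := r - min r (a x)) (by omega)
    refine ⟨Function.update d x (min r (a x)), fun i => ?_, ?_⟩
    · by_cases h : i = x
      · subst h
        simp
      · simp [h, hd i]
    · rw [Finset.sum_insert hx, Function.update_self, Finset.sum_congr rfl (g := d), hsum]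
      · omega
      · intro i hi
        exact Function.update_of_ne (ne_of_mem_of_not_mem hi hx) _ _

lemma IsNet.card_dualNet_le (hP : IsNet t m s fun n : Fin (2 ^ m) => netPoint m s C (n : ℕ))
    (htm : t ≤ m) {A : Fin s → ℕ} (hA : ∀ i, A i ≤ m) (hA0 : m ≤ a0F A + t) :
    ((dualNet m s C).filter fun mm => ∀ i, rhoF (mm i) ≤ A i).card ≤ 2 ^ (a0F A + t - m) := by
  obtain ⟨d, hdA, hsum⟩ := exists_le_sum_eq Finset.univ A (r := m - t) (by
    unfold a0F at hA0
    omega)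
  have hcard : Fintype.card (∀ i, Fin (A i - d i) → ZMod 2) = 2 ^ (a0F A + t - m) := by
    rw [Fintype.card_pi]
    simp only [Fintype.card_fun, ZMod.card, Fintype.card_fin]
    rw [Finset.prod_pow_eq_pow_sum]
    congr 1
    have h : ∑ i, (A i - d i) + ∑ i, d i = ∑ i, A i := by
      rw [← Finset.sum_add_distrib]
      exact Finset.sum_congr rfl fun i _ => Nat.sub_add_cancel (hdA i)
    unfold a0F at hA0 ⊢
    omega
  rw [← hcard, ← Finset.card_univ]
  refine Finset.card_le_card_of_injOn
    (fun mm i l => mm i ⟨d i + l, by have := hA i; omega⟩)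
    (fun _ _ => Finset.mem_coe.2 (Finset.mem_univ _)) ?_
  intro μ hμ ν hν h
  simp only [Finset.coe_filter, Set.mem_ofPred_eq] at hμ hν
  rw [← sub_eq_zero]
  refine hP.dualNet_eq_zero (fun i => (hdA i).trans (hA i)) (by omega) ?_ ?_
  · have h1 := (Finset.mem_filter.1 hμ.1).2
    have h2 := (Finset.mem_filter.1 hν.1).2
    refine Finset.mem_filter.2 ⟨Finset.mem_univ _, fun n => ?_⟩
    simp only [Pi.sub_apply, sub_mul, Finset.sum_sub_distrib, h1 n, h2 n, sub_zero]
  · intro i j hj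
    rw [Pi.sub_apply, Pi.sub_apply, sub_eq_zero]
    by_cases hjA : (j : ℕ) < A i
    · have := congrFun (congrFun h i) ⟨j - d i, by omega⟩
      have hj' : (⟨d i + (j - d i), by omega⟩ : Fin m) = j := by
        ext
        simp only
        omega
      simpa only [hj'] using this
    · rw [eq_zero_of_rhoF_le (hμ.2 i) (not_lt.1 hjA), eq_zero_of_rhoF_le (hν.2 i) (not_lt.1 hjA)]

lemma IsNet.abs_PsiF_le (hP : IsNet t m s fun n : Fin (2 ^ m) => netPoint m s C (n : ℕ))
    (htm : t ≤ m) {A : Fin s → ℕ} (hA : ∀ i, A i ≤ m) (hA0 : m ≤ a0F A + t)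
    (T Y : Fin s → Fin m → Fin 2) : |PsiF m s C A T Y| ≤ 2 ^ t := by
  have hLam : |LamF m s C A T Y| ≤ (2 : ℝ) ^ (a0F A + t - m) := by
    unfold LamF
    refine (Finset.abs_sum_le_sum_abs _ _).trans ?_
    simp only [abs_pow, abs_neg, abs_one, one_pow, Finset.sum_const, nsmul_eq_mul, mul_one]
    exact_mod_cast (Finset.card_le_card fun x hx => by
      simp only [Finset.mem_filter] at hx ⊢
      exact ⟨hx.1, hx.2.2⟩).trans (hP.card_dualNet_le htm hA hA0)
  have hr : |rademF A Y| = 1 := by simp [rademF, Finset.abs_prod]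
  unfold PsiF
  rw [abs_mul, abs_mul, abs_mul, hr, abs_pow, abs_neg, abs_one, one_pow, one_mul, mul_one,
    abs_of_pos (by positivity)]
  calc (2 : ℝ) ^ ((m : ℤ) - (s : ℤ) - (a0F A : ℤ)) * |LamF m s C A T Y|
      ≤ (2 : ℝ) ^ ((m : ℤ) - (s : ℤ) - (a0F A : ℤ)) * (2 : ℝ) ^ ((a0F A + t - m : ℕ) : ℤ) := by
        rw [zpow_natCast]
        gcongr
    _ = (2 : ℝ) ^ ((t : ℤ) - s) := by
        rw [← zpow_add₀ two_ne_zero]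
        congr 1
        omega
    _ ≤ (2 : ℝ) ^ (t : ℤ) := zpow_le_zpow_right₀ one_le_two (by omega)
    _ = 2 ^ t := zpow_natCast _ _

lemma IsNet.abs_Em_ThetaF_mul_le
    (hP : IsNet t m s fun n : Fin (2 ^ m) => netPoint m s C (n : ℕ)) (htm : t ≤ m)
    {A1 A2 A3 A4 : Fin s → ℕ} (h1 : ∀ i, A1 i ≤ m) (h2 : ∀ i, A2 i ≤ m)
    (h3 : ∀ i, A3 i ≤ m) (h4 : ∀ i, A4 i ≤ m) (h1' : m ≤ a0F A1 + t) (h2' : m ≤ a0F A2 + t)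
    (h3' : m ≤ a0F A3 + t) (h4' : m ≤ a0F A4 + t) (h12 : A1 ≠ A2) (h34 : A3 ≠ A4) (k l : ℕ) :
    |Em m s fun t y => ThetaF m s C A1 A2 k t y * ThetaF m s C A3 A4 l t y| ≤
      (2 : ℝ) ^ (4 * t) := by
  have hΨ : ∀ {A B : Fin s → ℕ}, (∀ i, A i ≤ m) → (∀ i, B i ≤ m) → m ≤ a0F A + t →
      m ≤ a0F B + t → ∀ T Y, |PsiF m s C A T Y * PsiF m s C B T Y| ≤ (2 : ℝ) ^ t * 2 ^ t := by
    intro A B hA hB hA' hB' T Y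
    rw [abs_mul]
    exact mul_le_mul (hP.abs_PsiF_le htm hA hA' T Y) (hP.abs_PsiF_le htm hB hB' T Y)
      (abs_nonneg _) (by positivity)
  refine abs_Em_le fun T Y => ?_
  rw [ThetaF_eq_EmCond C h1 h2 h12, ThetaF_eq_EmCond C h3 h4 h34, abs_mul]
  refine (mul_le_mul (abs_EmCond_le _ (hΨ h1 h2 h1' h2') T Y)
    (abs_EmCond_le _ (hΨ h3 h4 h3' h4') T Y) (abs_nonneg _) (by positivity)).trans_eq ?_
  ring

end Net

/-- The multi-indices `A ∈ I_m^s` with `a₀(A) ∈ (m - t_m, m + V₀)`. -/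
def indexWindow (m s tm : ℕ) : Finset (Fin s → ℕ) :=
  (Fintype.piFinset fun _ : Fin s => Finset.range (m + 1)).filter fun A =>
    (m : ℝ) - tm < a0F A ∧ (a0F A : ℝ) < m + V0 m

/-- The coincidence pattern forced on `(A₁, A₂, A₃, A₄)` by a nonzero expectation. -/
def IsLinked {s : ℕ} (J : Finset (Fin s)) (A1 A2 A3 A4 : Fin s → ℕ) : Prop :=
  (∀ i ∈ J, A1 i = A2 i ∧ A3 i = A4 i) ∧ ∀ i ∉ J, A1 i = A3 i ∧ A2 i = A4 i

section Count

variable {m s tm : ℕ}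

lemma IndexSet_eq_filter (k : ℕ) :
    IndexSet m s tm k = (indexWindow m s tm).filter fun A => Finset.univ.sup A = k := by
  ext A
  simp only [IndexSet, indexWindow, Finset.mem_filter]
  tauto

lemma le_of_mem_indexWindow {A : Fin s → ℕ} (hA : A ∈ indexWindow m s tm) (i : Fin s) :
    A i ≤ m :=
  Nat.lt_succ_iff.1 (Finset.mem_range.1
    (Fintype.mem_piFinset.1 (Finset.mem_filter.1 hA).1 i))

lemma le_a0F_of_mem_indexWindow {A : Fin s → ℕ} (hA : A ∈ indexWindow m s tm) :
    m ≤ a0F A + tm := by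
  have := (Finset.mem_filter.1 hA).2.1
  have h : (m : ℝ) < ((a0F A + tm : ℕ) : ℝ) := by
    push_cast
    linarith
  exact_mod_cast h.le

lemma a0F_mem_Icc_of_mem_indexWindow {A : Fin s → ℕ} (hA : A ∈ indexWindow m s tm) :
    a0F A ∈ Finset.Icc (m - tm) (m + ⌊V0 m⌋₊) := by
  have h1 := le_a0F_of_mem_indexWindow hA
  have h2 := (Finset.mem_filter.1 hA).2.2
  have h3 : a0F A - m ≤ ⌊V0 m⌋₊ := by
    rcases le_total (a0F A) m with h | h
    · simp [Nat.sub_eq_zero_of_le h]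
    · refine Nat.le_floor ?_
      rw [Nat.cast_sub h]
      linarith
  rw [Finset.mem_Icc]
  omega

lemma sum_IndexSet_le {h : (Fin s → ℕ) → (Fin s → ℕ) → ℝ} (hh : ∀ A B, 0 ≤ h A B)
    (K : Finset ℕ) :
    ∑ k ∈ K, ∑ A ∈ IndexSet m s tm k, ∑ B ∈ IndexSet m s tm k, h A B ≤
      ∑ A ∈ indexWindow m s tm, ∑ B ∈ indexWindow m s tm, h A B := by
  calc ∑ k ∈ K, ∑ A ∈ IndexSet m s tm k, ∑ B ∈ IndexSet m s tm k, h A B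
      ≤ ∑ k ∈ K, ∑ A ∈ (indexWindow m s tm).filter fun A => Finset.univ.sup A = k,
          ∑ B ∈ indexWindow m s tm, h A B := by
        simp only [IndexSet_eq_filter]
        exact Finset.sum_le_sum fun k _ => Finset.sum_le_sum fun A _ =>
          Finset.sum_le_sum_of_subset_of_nonneg (Finset.filter_subset _ _) fun B _ _ => hh A B
    _ ≤ ∑ A ∈ indexWindow m s tm, ∑ B ∈ indexWindow m s tm, h A B :=
        Finset.sum_fiberwise_le_sum_of_sum_fiber_nonneg fun _ _ =>
          Finset.sum_nonneg fun A _ => Finset.sum_nonneg fun B _ => hh A B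

lemma eq_of_a0F_eq {A B : Fin s → ℕ} (i₀ : Fin s) (h : ∀ i ≠ i₀, A i = B i)
    (h0 : a0F A = a0F B) : A = B := by
  have hA := Finset.add_sum_erase _ A (Finset.mem_univ i₀)
  have hB := Finset.add_sum_erase _ B (Finset.mem_univ i₀)
  have hAB : ∑ i ∈ Finset.univ.erase i₀, A i = ∑ i ∈ Finset.univ.erase i₀, B i :=
    Finset.sum_congr rfl fun i hi => h i (Finset.ne_of_mem_erase hi)
  unfold a0F at h0
  funext i
  by_cases hi : i = i₀
  · subst hi
    omega
  · exact h i hi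

lemma card_piFinset_zero_on (P : Finset (Fin s)) :
    (Fintype.piFinset fun i => if i ∈ P then {0} else Finset.range (m + 1)).card =
      (m + 1) ^ (s - P.card) := by
  have h : ∀ i : Fin s, (if i ∈ P then {0} else Finset.range (m + 1)).card =
      if i ∈ P then 1 else m + 1 := by
    intro i
    split_ifs <;> simp
  simp only [Fintype.card_piFinset, h]
  rw [Finset.prod_ite, Finset.prod_const_one, one_mul, Finset.prod_const]
  congr 1
  rw [Finset.filter_not, Finset.filter_mem_eq_inter, Finset.univ_inter,
    Finset.card_sdiff_of_subset (Finset.subset_univ _), Finset.card_univ, Fintype.card_fin]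

lemma zero_on_mem_piFinset {A : Fin s → ℕ} (hA : ∀ i, A i ≤ m) (P : Finset (Fin s)) :
    (fun i => if i ∈ P then 0 else A i) ∈
      Fintype.piFinset fun i => if i ∈ P then {0} else Finset.range (m + 1) := by
  rw [Fintype.mem_piFinset]
  intro i
  by_cases hi : i ∈ P
  · simp [hi]
  · simpa [hi, Nat.lt_succ_iff] using hA i

/-- Linked quadruples have `2s - 3` free coordinates up to the choice of three coordinate sums. -/
lemma card_isLinked_le {J : Finset (Fin s)} {i₀ i₁ : Fin s} (h₀ : i₀ ∈ J) (h₁ : i₁ ∉ J)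
    {W : Finset (Fin s → ℕ)} {N : Finset ℕ} (hW : ∀ A ∈ W, ∀ i, A i ≤ m)
    (hN : ∀ A ∈ W, a0F A ∈ N) :
    ((W ×ˢ W ×ˢ W ×ˢ W).filter fun q => IsLinked J q.1 q.2.1 q.2.2.1 q.2.2.2).card ≤
      (m + 1) ^ (s - 1) * ((m + 1) ^ (s - 2) * (N.card * (N.card * N.card))) := by
  have hne : i₀ ≠ i₁ := ne_of_mem_of_not_mem h₀ h₁
  have hcard : ((Fintype.piFinset fun i => if i ∈ ({i₀} : Finset (Fin s)) then {0}
        else Finset.range (m + 1)) ×ˢ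
      (Fintype.piFinset fun i => if i ∈ ({i₀, i₁} : Finset (Fin s)) then {0}
        else Finset.range (m + 1)) ×ˢ N ×ˢ N ×ˢ N).card =
      (m + 1) ^ (s - 1) * ((m + 1) ^ (s - 2) * (N.card * (N.card * N.card))) := by
    simp only [Finset.card_product, card_piFinset_zero_on, Finset.card_singleton,
      Finset.card_pair hne]
  rw [← hcard]
  refine Finset.card_le_card_of_injOn
    (fun q => (fun i => if i ∈ ({i₀} : Finset (Fin s)) then 0 else q.1 i,
      fun i => if i ∈ ({i₀, i₁} : Finset (Fin s)) then 0 else q.2.2.2 i,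
      a0F q.1, a0F q.2.1, a0F q.2.2.1)) ?_ ?_
  · rintro ⟨A1, A2, A3, A4⟩ hq
    simp only [Finset.coe_filter, Set.mem_ofPred_eq, Finset.mem_product] at hq
    obtain ⟨⟨h1, h2, h3, h4⟩, -⟩ := hq
    simp only [Finset.mem_coe, Finset.mem_product]
    exact ⟨zero_on_mem_piFinset (hW _ h1) _, zero_on_mem_piFinset (hW _ h4) _,
      hN _ h1, hN _ h2, hN _ h3⟩
  · rintro ⟨A1, A2, A3, A4⟩ hq ⟨B1, B2, B3, B4⟩ hr h
    simp only [Finset.coe_filter, Set.mem_ofPred_eq] at hq hr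
    obtain ⟨-, hA, hA'⟩ := hq
    obtain ⟨-, hB, hB'⟩ := hr
    simp only [Prod.mk.injEq] at h hA hA' hB hB'
    obtain ⟨e1, e4, s1, s2, s3⟩ := h
    have e1' : ∀ i ≠ i₀, A1 i = B1 i := by
      intro i hi
      simpa [hi] using congrFun e1 i
    have e4' : ∀ i, i ≠ i₀ → i ≠ i₁ → A4 i = B4 i := by
      intro i hi hi'
      simpa [hi, hi'] using congrFun e4 i
    obtain rfl := eq_of_a0F_eq i₀ e1' s1
    have e2 : A2 = B2 := by
      refine eq_of_a0F_eq i₁ (fun i hi => ?_) s2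
      by_cases hJ : i ∈ J
      · rw [← (hA i hJ).1, (hB i hJ).1]
      · rw [(hA' i hJ).2, (hB' i hJ).2, e4' i (ne_of_mem_of_not_mem h₀ hJ).symm hi]
    have e3 : A3 = B3 := by
      refine eq_of_a0F_eq i₀ (fun i hi => ?_) s3
      by_cases hJ : i ∈ J
      · rw [(hA i hJ).2, (hB i hJ).2, e4' i hi (ne_of_mem_of_not_mem hJ h₁)]
      · rw [← (hA' i hJ).1, (hB' i hJ).1]
    subst e2 e3
    have e4'' : A4 = B4 := by
      funext i
      by_cases hJ : i ∈ J
      · rw [← (hA i hJ).2, (hB i hJ).2]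
      · rw [← (hA' i hJ).2, (hB' i hJ).2]
    rw [e4'']

end Count

section Upsilon

variable {m s t : ℕ} {C : Fin s → Matrix (Fin m) (Fin m) (ZMod 2)} {J1 J2 J3 : Finset (Fin s)}

lemma isLinked_of_Em_ne_zero (hJ : J1 ∪ J2 ∪ J3 = Finset.univ) (hJ1 : J1.card < s)
    {A1 A2 A3 A4 : Fin s → ℕ} (h1 : ∀ i, A1 i ≤ m) (h2 : ∀ i, A2 i ≤ m)
    (h3 : ∀ i, A3 i ≤ m) (h4 : ∀ i, A4 i ≤ m) {k l : ℕ} (hk : 1 ≤ k)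
    (hA1k : Finset.univ.sup A1 = k)
    (e1 : (Finset.univ.filter fun i => A1 i = A2 i) = J1)
    (e2 : (Finset.univ.filter fun i => A1 i < A2 i) = J2)
    (e3 : (Finset.univ.filter fun i => A2 i < A1 i) = J3)
    (e4 : (Finset.univ.filter fun i => A3 i = A4 i) = J1)
    (e5 : (Finset.univ.filter fun i => A3 i < A4 i) = J2)
    (e6 : (Finset.univ.filter fun i => A4 i < A3 i) = J3)
    (h : (Em m s fun t y => ThetaF m s C A1 A2 k t y * ThetaF m s C A3 A4 l t y) ≠ 0) :
    A1 ≠ A2 ∧ A3 ≠ A4 ∧ J1.Nonempty ∧ IsLinked J1 A1 A2 A3 A4 := by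
  have h12 : A1 ≠ A2 := by
    rintro rfl
    simp only [Finset.filter_true, ← e1, Finset.card_univ, Fintype.card_fin] at hJ1
    exact lt_irrefl _ hJ1
  have h34 : A3 ≠ A4 := by
    rintro rfl
    simp only [Finset.filter_true, ← e4, Finset.card_univ, Fintype.card_fin] at hJ1
    exact lt_irrefl _ hJ1
  have m1 : ∀ i, i ∈ J1 ↔ A1 i = A2 i := by simp [← e1]
  have m2 : ∀ i, i ∈ J2 ↔ A1 i < A2 i := by simp [← e2]
  have m3 : ∀ i, i ∈ J3 ↔ A2 i < A1 i := by simp [← e3]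
  have m4 : ∀ i, i ∈ J1 ↔ A3 i = A4 i := by simp [← e4]
  have m5 : ∀ i, i ∈ J2 ↔ A3 i < A4 i := by simp [← e5]
  have m6 : ∀ i, i ∈ J3 ↔ A4 i < A3 i := by simp [← e6]
  refine ⟨h12, h34, ?_, fun i hi => ⟨(m1 i).1 hi, (m4 i).1 hi⟩, fun i hi => ?_⟩
  · by_contra hempty
    refine h ?_
    have hΘ : ∀ t y, ThetaF m s C A1 A2 k t y = 0 := by
      intro t y
      by_contra hne
      obtain ⟨i, hi⟩ := exists_eq_of_ThetaF_ne_zero C h1 h2 h12 hk hA1k hne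
      exact hempty ⟨i, (m1 i).2 hi⟩
    simp [Em, hΘ]
  · have hsign := flipSign_prod_eq_one C h1 h2 h3 h4 h12 h34 h i
    have hmem : i ∈ J1 ∪ J2 ∪ J3 := hJ ▸ Finset.mem_univ i
    simp only [Finset.mem_union, hi, false_or] at hmem
    rcases hmem with hi2 | hi3
    · exact eq_and_eq_of_flipSign (h2 i) (h4 i) ((m2 i).1 hi2) ((m5 i).1 hi2) hsign
    · refine (eq_and_eq_of_flipSign (h1 i) (h3 i) ((m3 i).1 hi3) ((m6 i).1 hi3)
        fun j => ?_).symm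
      rw [← hsign j]
      ring

lemma IsNet.abs_Ups_le (hP : IsNet t m s fun n : Fin (2 ^ m) => netPoint m s C (n : ℕ))
    (htm : t ≤ m) (hJ : J1 ∪ J2 ∪ J3 = Finset.univ) (hJ1 : J1.card < s) {k l : ℕ} (hk : 1 ≤ k) :
    |Ups m s t C J1 J2 J3 k l| ≤
      ∑ A1 ∈ IndexSet m s t k, ∑ A2 ∈ IndexSet m s t k,
        ∑ A3 ∈ IndexSet m s t l, ∑ A4 ∈ IndexSet m s t l,
          if J1.Nonempty ∧ IsLinked J1 A1 A2 A3 A4 then (2 : ℝ) ^ (4 * t) else 0 := by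
  unfold Ups
  refine (Finset.abs_sum_le_sum_abs _ _).trans (Finset.sum_le_sum fun A1 hA1 => ?_)
  refine (Finset.abs_sum_le_sum_abs _ _).trans (Finset.sum_le_sum fun A2 hA2 => ?_)
  refine (Finset.abs_sum_le_sum_abs _ _).trans (Finset.sum_le_sum fun A3 hA3 => ?_)
  refine (Finset.abs_sum_le_sum_abs _ _).trans (Finset.sum_le_sum fun A4 hA4 => ?_)
  rw [IndexSet_eq_filter, Finset.mem_filter] at hA1 hA2 hA3 hA4
  have hnonneg : (0 : ℝ) ≤
      if J1.Nonempty ∧ IsLinked J1 A1 A2 A3 A4 then (2 : ℝ) ^ (4 * t) else 0 := by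
    split_ifs <;> positivity
  by_cases hE : (Em m s fun t y => ThetaF m s C A1 A2 k t y * ThetaF m s C A3 A4 l t y) = 0
  · rw [hE, zero_mul, abs_zero]
    exact hnonneg
  by_cases hpat : (Finset.univ.filter fun i => A1 i = A2 i) = J1 ∧
      (Finset.univ.filter fun i => A1 i < A2 i) = J2 ∧
      (Finset.univ.filter fun i => A2 i < A1 i) = J3 ∧
      (Finset.univ.filter fun i => A3 i = A4 i) = J1 ∧
      (Finset.univ.filter fun i => A3 i < A4 i) = J2 ∧
      (Finset.univ.filter fun i => A4 i < A3 i) = J3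
  · obtain ⟨e1, e2, e3, e4, e5, e6⟩ := id hpat
    have h1 := le_of_mem_indexWindow hA1.1
    have h2 := le_of_mem_indexWindow hA2.1
    have h3 := le_of_mem_indexWindow hA3.1
    have h4 := le_of_mem_indexWindow hA4.1
    obtain ⟨h12, h34, hlinked⟩ :=
      isLinked_of_Em_ne_zero hJ hJ1 h1 h2 h3 h4 hk hA1.2 e1 e2 e3 e4 e5 e6 hE
    rw [if_pos hpat, if_pos hlinked, mul_one]
    exact hP.abs_Em_ThetaF_mul_le htm h1 h2 h3 h4 (le_a0F_of_mem_indexWindow hA1.1)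
      (le_a0F_of_mem_indexWindow hA2.1) (le_a0F_of_mem_indexWindow hA3.1)
      (le_a0F_of_mem_indexWindow hA4.1) h12 h34 k l
  · rw [if_neg hpat, mul_zero, abs_zero]
    exact hnonneg

/-- Summing over both levels `k₁, k₂` reduces to counting linked quadruples. -/
lemma IsNet.sum_abs_Ups_le (hP : IsNet t m s fun n : Fin (2 ^ m) => netPoint m s C (n : ℕ))
    (htm : t ≤ m) (hJ : J1 ∪ J2 ∪ J3 = Finset.univ) (hJ1 : J1.card < s) :
    ∑ k1 ∈ Finset.Icc 1 m, ∑ k2 ∈ Finset.Icc 1 m, |Ups m s t C J1 J2 J3 k1 k2| ≤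
      (m + 1 : ℝ) ^ (s - 1) * ((m + 1 : ℝ) ^ (s - 2) * ((t + ⌊V0 m⌋₊ + 1 : ℕ) : ℝ) ^ 3) *
        2 ^ (4 * t) := by
  set W := indexWindow m s t
  set g : (Fin s → ℕ) → (Fin s → ℕ) → (Fin s → ℕ) → (Fin s → ℕ) → ℝ := fun A1 A2 A3 A4 =>
    if J1.Nonempty ∧ IsLinked J1 A1 A2 A3 A4 then (2 : ℝ) ^ (4 * t) else 0 with hg
  have hg0 : ∀ A1 A2 A3 A4, 0 ≤ g A1 A2 A3 A4 := by
    intro A1 A2 A3 A4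
    simp only [hg]
    split_ifs <;> positivity
  have hsum : ∑ k1 ∈ Finset.Icc 1 m, ∑ k2 ∈ Finset.Icc 1 m, |Ups m s t C J1 J2 J3 k1 k2| ≤
      ∑ A1 ∈ W, ∑ A2 ∈ W, ∑ A3 ∈ W, ∑ A4 ∈ W, g A1 A2 A3 A4 := by
    calc ∑ k1 ∈ Finset.Icc 1 m, ∑ k2 ∈ Finset.Icc 1 m, |Ups m s t C J1 J2 J3 k1 k2|
        ≤ ∑ k1 ∈ Finset.Icc 1 m, ∑ k2 ∈ Finset.Icc 1 m,
            ∑ A1 ∈ IndexSet m s t k1, ∑ A2 ∈ IndexSet m s t k1,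
              ∑ A3 ∈ IndexSet m s t k2, ∑ A4 ∈ IndexSet m s t k2, g A1 A2 A3 A4 :=
          Finset.sum_le_sum fun k1 hk1 => Finset.sum_le_sum fun k2 _ =>
            hP.abs_Ups_le htm hJ hJ1 (Finset.mem_Icc.1 hk1).1
      _ = ∑ k1 ∈ Finset.Icc 1 m, ∑ A1 ∈ IndexSet m s t k1, ∑ A2 ∈ IndexSet m s t k1,
            ∑ k2 ∈ Finset.Icc 1 m,
              ∑ A3 ∈ IndexSet m s t k2, ∑ A4 ∈ IndexSet m s t k2, g A1 A2 A3 A4 := by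
          refine Finset.sum_congr rfl fun k1 _ => ?_
          rw [Finset.sum_comm]
          exact Finset.sum_congr rfl fun A1 _ => Finset.sum_comm
      _ ≤ ∑ k1 ∈ Finset.Icc 1 m, ∑ A1 ∈ IndexSet m s t k1, ∑ A2 ∈ IndexSet m s t k1,
            ∑ A3 ∈ W, ∑ A4 ∈ W, g A1 A2 A3 A4 :=
          Finset.sum_le_sum fun k1 _ => Finset.sum_le_sum fun A1 _ =>
            Finset.sum_le_sum fun A2 _ => sum_IndexSet_le (hg0 A1 A2) _
      _ ≤ ∑ A1 ∈ W, ∑ A2 ∈ W, ∑ A3 ∈ W, ∑ A4 ∈ W, g A1 A2 A3 A4 :=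
          sum_IndexSet_le (fun A1 A2 => Finset.sum_nonneg fun A3 _ =>
            Finset.sum_nonneg fun A4 _ => hg0 A1 A2 A3 A4) _
  refine hsum.trans ?_
  by_cases hne : J1.Nonempty
  swap
  · simp only [hg, hne, false_and, if_false, Finset.sum_const_zero]
    positivity
  obtain ⟨i₀, h₀⟩ := hne
  obtain ⟨i₁, -, h₁⟩ : ∃ i ∈ Finset.univ, i ∉ J1 :=
    Finset.exists_mem_notMem_of_card_lt_card (by simpa using hJ1)
  have hcount := card_isLinked_le h₀ h₁ (fun A hA => le_of_mem_indexWindow (m := m) (tm := t) hA)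
    fun A hA => a0F_mem_Icc_of_mem_indexWindow hA
  have hN : (Finset.Icc (m - t) (m + ⌊V0 m⌋₊)).card = t + ⌊V0 m⌋₊ + 1 := by
    rw [Nat.card_Icc]
    omega
  rw [hN] at hcount
  have hcount' : ((((W ×ˢ W ×ˢ W ×ˢ W).filter fun q =>
      IsLinked J1 q.1 q.2.1 q.2.2.1 q.2.2.2).card : ℕ) : ℝ) ≤
      (m + 1 : ℝ) ^ (s - 1) * ((m + 1 : ℝ) ^ (s - 2) * ((t + ⌊V0 m⌋₊ + 1 : ℕ) : ℝ) ^ 3) := by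
    rw [pow_three]
    exact_mod_cast hcount
  refine le_trans (le_of_eq ?_) (mul_le_mul_of_nonneg_right hcount' (by positivity))
  rw [← nsmul_eq_mul, ← Finset.sum_const, Finset.sum_filter]
  simp only [Finset.sum_product]
  simp only [hg, show J1.Nonempty from ⟨i₀, h₀⟩, true_and]

end Upsilon

lemma one_add_log_window_le {m : ℕ} (hm : 1 ≤ m) {t : ℕ} (ht : (t : ℝ) ≤ Real.logb 2 m / 10) :
    ((t + ⌊V0 m⌋₊ + 1 : ℕ) : ℝ) ≤ 200 * (m : ℝ) ^ (2 / 15 : ℝ) := by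
  have hm' : (1 : ℝ) ≤ m := by exact_mod_cast hm
  have hlog : Real.log m ≤ (m : ℝ) ^ (2 / 15 : ℝ) / (2 / 15) :=
    Real.log_le_rpow_div (by positivity) (by norm_num)
  have hone : (1 : ℝ) ≤ (m : ℝ) ^ (2 / 15 : ℝ) := Real.one_le_rpow hm' (by norm_num)
  have hlogb : Real.logb 2 m ≤ 15 * (m : ℝ) ^ (2 / 15 : ℝ) := by
    have h2 := Real.log_two_gt_d9
    rw [Real.logb, div_le_iff₀ (by linarith)]
    nlinarith
  have hlogb0 : 0 ≤ Real.logb 2 m := Real.logb_nonneg one_lt_two hm'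
  have hV : (⌊V0 m⌋₊ : ℝ) ≤ 10 * Real.logb 2 m := Nat.floor_le (by unfold V0; positivity)
  push_cast
  linarith

lemma two_pow_four_mul_le {m : ℕ} (hm : 1 ≤ m) {t : ℕ} (ht : (t : ℝ) ≤ Real.logb 2 m / 10) :
    (2 : ℝ) ^ (4 * t) ≤ (m : ℝ) ^ (2 / 5 : ℝ) := by
  have hm' : (0 : ℝ) < m := by exact_mod_cast hm
  calc (2 : ℝ) ^ (4 * t) = (2 : ℝ) ^ ((4 * t : ℕ) : ℝ) := (Real.rpow_natCast _ _).symm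
    _ ≤ (2 : ℝ) ^ (Real.logb 2 m * (2 / 5)) :=
        Real.rpow_le_rpow_of_exponent_le one_le_two (by push_cast; linarith)
    _ = (m : ℝ) ^ (2 / 5 : ℝ) := by
        rw [Real.rpow_mul two_pos.le, Real.rpow_logb two_pos (by norm_num) hm']

lemma le_of_le_logb {m t : ℕ} (hm : 1 ≤ m) (ht : (t : ℝ) ≤ Real.logb 2 m / 10) : t ≤ m := by
  have hm' : (1 : ℝ) ≤ m := by exact_mod_cast hm
  have h1 := Real.log_le_sub_one_of_pos (zero_lt_one.trans_le hm')
  have h2 := Real.log_two_gt_d9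
  have h3 : Real.logb 2 m ≤ 10 * m := by
    rw [Real.logb, div_le_iff₀ (by linarith)]
    nlinarith
  exact_mod_cast ht.trans (by linarith : Real.logb 2 m / 10 ≤ m)

/-- Lemma 6: for any partition `J = (J₁,J₂,J₃)` of `{1,…,s}`
with `d₁ = #J₁ < s`, `∑_{k₁,k₂=1}^m |Υ_{d₁,d₂,d₃,J,(k₁,k₂)}| ≪ m^{2(s-1)-1/5}`,
with the implied constant depending only on `s`. -/
theorem statement14 (s : ℕ) (hs : 2 ≤ s) :
    ∃ c : ℝ, 0 < c ∧ ∀ J1 J2 J3 : Finset (Fin s),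
      J1 ∪ J2 ∪ J3 = Finset.univ → Disjoint J1 J2 → Disjoint J1 J3 → Disjoint J2 J3 →
      J1.card < s →
      ∀ (m tm : ℕ), 1 ≤ m →
        ∀ C : Fin s → Matrix (Fin m) (Fin m) (ZMod 2),
          IsNet tm m s (fun n : Fin (2 ^ m) => netPoint m s C (n : ℕ)) →
          (tm : ℝ) ≤ Real.logb 2 m / 10 →
          (∑ k1 ∈ Finset.Icc 1 m, ∑ k2 ∈ Finset.Icc 1 m,
              |Ups m s tm C J1 J2 J3 k1 k2|) ≤
            c * (m : ℝ) ^ (2 * ((s : ℝ) - 1) - 1 / 5) := by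
  refine ⟨2 ^ (2 * s) * 200 ^ 3, by positivity, ?_⟩
  intro J1 J2 J3 hJ _ _ _ hJ1 m tm hm C hP htm
  have hm' : (1 : ℝ) ≤ m := by exact_mod_cast hm
  have hm0 : (0 : ℝ) < m := by linarith
  refine (hP.sum_abs_Ups_le (le_of_le_logb hm htm) hJ hJ1).trans ?_
  have hpow : (m + 1 : ℝ) ^ (s - 1) * (m + 1 : ℝ) ^ (s - 2) ≤
      2 ^ (2 * s) * (m : ℝ) ^ (2 * (s : ℝ) - 3) := by
    calc (m + 1 : ℝ) ^ (s - 1) * (m + 1 : ℝ) ^ (s - 2) = (m + 1 : ℝ) ^ (2 * s - 3) := by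
          rw [← pow_add]
          congr 1
          omega
      _ ≤ (2 * m : ℝ) ^ (2 * s - 3) := by
          gcongr
          linarith
      _ = 2 ^ (2 * s - 3) * (m : ℝ) ^ (2 * s - 3) := mul_pow _ _ _
      _ ≤ 2 ^ (2 * s) * (m : ℝ) ^ (2 * s - 3) := by
          gcongr
          · norm_num
          · omega
      _ = 2 ^ (2 * s) * (m : ℝ) ^ (2 * (s : ℝ) - 3) := by
          rw [← Real.rpow_natCast (m : ℝ), Nat.cast_sub (by omega)]
          push_cast
          rfl
  have hexp : (m : ℝ) ^ (2 * ((s : ℝ) - 1) - 1 / 5) =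
      (m : ℝ) ^ (2 * (s : ℝ) - 3) * ((m : ℝ) ^ (2 / 15 : ℝ)) ^ 3 * (m : ℝ) ^ (2 / 5 : ℝ) := by
    rw [← Real.rpow_natCast ((m : ℝ) ^ (2 / 15 : ℝ)), ← Real.rpow_mul hm0.le,
      ← Real.rpow_add hm0, ← Real.rpow_add hm0]
    congr 1
    push_cast
    ring
  rw [← mul_assoc]
  calc _ ≤ 2 ^ (2 * s) * (m : ℝ) ^ (2 * (s : ℝ) - 3) *
        (200 * (m : ℝ) ^ (2 / 15 : ℝ)) ^ 3 * (m : ℝ) ^ (2 / 5 : ℝ) := by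
        gcongr
        · exact one_add_log_window_le hm htm
        · exact two_pow_four_mul_le hm htm
    _ = _ := by
        rw [hexp]
        ring
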